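/- arXiv:2506.24059 — 4 statements merged into one kernel-verified Lean document; each statement's English description precedes it below -/
import Mathlib

section
/- Let E be a real inner product space and let l be a natural number with l ≥ 2. Then for every continuously differentiable function f : ℝ → E whose support is a compact subset of the open interval (0, ∞), one has ∫_0^∞ ‖f(r)‖² r^{l-1} dr ≤ (1/(l-1)) ∫_0^∞ (‖f(r)‖² + ‖f′(r)‖²) r^{l} dr. -/
open MeasureTheory Set

/-- One-dimensional weighted Hardy-type inequality, with the constant `1 / l` written as a factor
on the left. -/
theorem natCast_mul_integral_norm_sq_mul_pow_le
    {E : Type*} [NormedAddCommGroup E] [InnerProductSpace ℝ E]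
    {l : ℕ} (hl : l ≠ 0) {f : ℝ → E} (hf : ContDiff ℝ 1 f) (hc : HasCompactSupport f) :
    l * ∫ r in Ioi (0 : ℝ), ‖f r‖ ^ 2 * r ^ (l - 1) ≤
      ∫ r in Ioi (0 : ℝ), (‖f r‖ ^ 2 + ‖deriv f r‖ ^ 2) * r ^ l := by
  have hf' : Continuous (deriv f) := hf.continuous_deriv le_rfl
  have hfc : Continuous f := hf.continuous
  have hsq : HasCompactSupport fun r ↦ ‖f r‖ ^ 2 := hc.comp_left (g := fun x ↦ ‖x‖ ^ 2) (by simp)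
  have hsq' : HasCompactSupport fun r ↦ ‖deriv f r‖ ^ 2 :=
    hc.deriv.comp_left (g := fun x ↦ ‖x‖ ^ 2) (by simp)
  set F : ℝ → ℝ := fun r ↦ ‖f r‖ ^ 2 * r ^ l with hF
  have hFc : HasCompactSupport F := hsq.mul_right
  have hFd : ContDiff ℝ 1 F := (hf.norm_sq ℝ).mul (contDiff_id.pow l)
  have hF0 : ∫ r in Ioi (0 : ℝ), deriv F r = 0 := by
    rw [hFc.integral_Ioi_deriv_eq hFd 0]
    simp [hF, hl]
  have hderiv (r : ℝ) :
      deriv F r = 2 * inner ℝ (f r) (deriv f r) * r ^ l + ‖f r‖ ^ 2 * (l * r ^ (l - 1)) :=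
    ((hf.differentiable one_ne_zero r).hasDerivAt.norm_sq.mul (hasDerivAt_pow l r)).deriv
  have hint₁ : Integrable fun r ↦ l * (‖f r‖ ^ 2 * r ^ (l - 1)) :=
    (Continuous.integrable_of_hasCompactSupport (by fun_prop) hsq.mul_right).const_mul _
  have hint₂ : Integrable fun r ↦ (‖f r‖ ^ 2 + ‖deriv f r‖ ^ 2) * r ^ l :=
    Continuous.integrable_of_hasCompactSupport (by fun_prop) (hsq.add hsq').mul_right
  have hint₃ : Integrable (deriv F) :=
    (hFd.continuous_deriv le_rfl).integrable_of_hasCompactSupport hFc.deriv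
  have hsum := integral_add (hint₂.integrableOn (s := Ioi 0)) hint₃.integrableOn
  rw [hF0, add_zero] at hsum
  rw [← integral_const_mul, ← hsum]
  refine setIntegral_mono_on hint₁.integrableOn (hint₂.add hint₃).integrableOn
    measurableSet_Ioi fun r hr ↦ ?_
  have hnonneg : 0 ≤ ‖f r + deriv f r‖ ^ 2 * r ^ l :=
    mul_nonneg (sq_nonneg _) (pow_nonneg (le_of_lt hr) l)
  rw [norm_add_sq_real] at hnonneg
  rw [hderiv]
  linarith

/-- One-dimensional model case of the boundedness of multiplication by `r^{-1/2}`
from the weighted `H¹`-space to the weighted `L²`-space on a metric cone over an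
`l`-dimensional link with `l ≥ 2`. -/
theorem mult_by_inv_sqrt_r_bounded_model
    {E : Type*} [NormedAddCommGroup E] [InnerProductSpace ℝ E]
    (l : ℕ) (hl : 2 ≤ l) (f : ℝ → E) (hf : ContDiff ℝ 1 f)
    (hcpt : IsCompact (tsupport f)) (hsupp : tsupport f ⊆ Set.Ioi (0 : ℝ)) :
    ∫ r in Set.Ioi (0 : ℝ), ‖f r‖ ^ 2 * r ^ (l - 1) ≤
      (1 / ((l : ℝ) - 1)) *
        ∫ r in Set.Ioi (0 : ℝ), (‖f r‖ ^ 2 + ‖deriv f r‖ ^ 2) * r ^ l := by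
  have hl1 : (0 : ℝ) < l - 1 := by
    have : (2 : ℝ) ≤ l := by exact_mod_cast hl
    linarith
  have hnonneg : 0 ≤ ∫ r in Ioi (0 : ℝ), ‖f r‖ ^ 2 * r ^ (l - 1) :=
    setIntegral_nonneg measurableSet_Ioi fun r hr ↦
      mul_nonneg (sq_nonneg _) (pow_nonneg (le_of_lt hr) _)
  have hmain := natCast_mul_integral_norm_sq_mul_pow_le (by lia : l ≠ 0) hf hcpt
  rw [one_div, ← div_eq_inv_mul, le_div_iff₀ hl1]
  linarith
end

section
/- Let E be a real inner product space and let l be a natural number with l ≥ 2. There exists a constant C > 0, depending only on l, such that for every continuously differentiable function f : ℝ → E whose support is a compact subset of the open interval (0, ∞), and for every ε with 0 < ε ≤ 1, one has ∫_0^ε ‖f(r)‖² r^{l} dr ≤ C · ε · ∫_0^∞ (‖f(r)‖² + ‖f′(r)‖²) r^{l} dr. -/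
open MeasureTheory Set

/-- The weight `r ^ l` is increasing, so integrating `(‖f‖² r ^ l)'` from `b` to `∞` bounds
the weighted density of `f` at `b` by its squared weighted `H¹`-norm. -/
theorem norm_sq_mul_pow_le_integral_Ioi
    {E : Type*} [NormedAddCommGroup E] [InnerProductSpace ℝ E]
    (l : ℕ) {f : ℝ → E} (hf : ContDiff ℝ 1 f) (hc : HasCompactSupport f)
    {b : ℝ} (hb : 0 < b) :
    ‖f b‖ ^ 2 * b ^ l ≤
      ∫ r in Set.Ioi (0 : ℝ), (‖f r‖ ^ 2 + ‖deriv f r‖ ^ 2) * r ^ l := by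
  have hG : ContDiff ℝ 1 (fun r => ‖f r‖ ^ 2 * r ^ l) :=
    (hf.norm_sq ℝ).mul (contDiff_id.pow l)
  have hGc : HasCompactSupport (fun r => ‖f r‖ ^ 2 * r ^ l) :=
    HasCompactSupport.mul_right (hc.comp_left (g := fun x => ‖x‖ ^ 2) (by simp))
  have hcont : Continuous (deriv f) := hf.continuous_deriv le_rfl
  have hint : Integrable (fun r => (‖f r‖ ^ 2 + ‖deriv f r‖ ^ 2) * r ^ l) := by
    refine Continuous.integrable_of_hasCompactSupport
      (((hf.continuous.norm.pow 2).add (hcont.norm.pow 2)).mul (continuous_pow l)) ?_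
    exact HasCompactSupport.mul_right
      ((hc.comp_left (g := fun x => ‖x‖ ^ 2) (by simp)).add
        (hc.deriv.comp_left (g := fun x => ‖x‖ ^ 2) (by simp)))
  have hGint : Integrable (deriv fun r => ‖f r‖ ^ 2 * r ^ l) :=
    (hG.continuous_deriv le_rfl).integrable_of_hasCompactSupport hGc.deriv
  have hFTC := hGc.integral_Ioi_deriv_eq hG b
  calc ‖f b‖ ^ 2 * b ^ l
      = ∫ r in Set.Ioi b, -deriv (fun r => ‖f r‖ ^ 2 * r ^ l) r := by
        rw [integral_neg, hFTC, neg_neg]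
    _ ≤ ∫ r in Set.Ioi b, (‖f r‖ ^ 2 + ‖deriv f r‖ ^ 2) * r ^ l := by
        refine setIntegral_mono_on hGint.neg.integrableOn hint.integrableOn
          measurableSet_Ioi fun r hr => ?_
        have hr0 : 0 < r := hb.trans hr
        have hd : HasDerivAt f (deriv f r) r :=
          (hf.differentiable one_ne_zero r).hasDerivAt
        have hderiv : deriv (fun r => ‖f r‖ ^ 2 * r ^ l) r = _ :=
          (hd.norm_sq.mul (hasDerivAt_pow l r)).deriv
        rw [hderiv]
        have h1 : -(2 * inner ℝ (f r) (deriv f r)) ≤ ‖f r‖ ^ 2 + ‖deriv f r‖ ^ 2 := by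
          linarith [norm_add_sq_real (f r) (deriv f r), sq_nonneg ‖f r + deriv f r‖]
        have h2 : 0 ≤ ‖f r‖ ^ 2 * (l * r ^ (l - 1)) := by positivity
        linarith [mul_le_mul_of_nonneg_right h1 (pow_nonneg hr0.le l)]
    _ ≤ ∫ r in Set.Ioi (0 : ℝ), (‖f r‖ ^ 2 + ‖deriv f r‖ ^ 2) * r ^ l := by
        refine setIntegral_mono_set hint.integrableOn ?_ (Ioi_subset_Ioi hb.le).eventuallyLE
        filter_upwards [ae_restrict_mem measurableSet_Ioi] with r hr
        have hr0 : 0 < r := hr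
        simp only [Pi.zero_apply]
        positivity

/-- One-dimensional model case of the tail estimate near the singular stratum in
the proof of the Rellich–Kondrachov compactness theorem for manifolds with
fiberwise asymptotically conical singularities: the weighted `L²`-norm of `f` on
`(0, ε)` is controlled by `C · ε` times the squared weighted `H¹`-norm. -/
theorem tail_estimate_model
    {E : Type*} [NormedAddCommGroup E] [InnerProductSpace ℝ E]
    (l : ℕ) (hl : 2 ≤ l) :
    ∃ C : ℝ, 0 < C ∧
      ∀ (f : ℝ → E), ContDiff ℝ 1 f → IsCompact (tsupport f) →
        tsupport f ⊆ Set.Ioi (0 : ℝ) →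
        ∀ ε : ℝ, 0 < ε → ε ≤ 1 →
          ∫ r in Set.Ioc (0 : ℝ) ε, ‖f r‖ ^ 2 * r ^ l ≤
            C * ε * ∫ r in Set.Ioi (0 : ℝ), (‖f r‖ ^ 2 + ‖deriv f r‖ ^ 2) * r ^ l := by
  refine ⟨1, one_pos, fun f hf hc _ ε hε _ => ?_⟩
  set H := ∫ r in Set.Ioi (0 : ℝ), (‖f r‖ ^ 2 + ‖deriv f r‖ ^ 2) * r ^ l
  have hcont : Continuous (fun r => ‖f r‖ ^ 2 * r ^ l) :=
    (hf.continuous.norm.pow 2).mul (continuous_pow l)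
  calc ∫ r in Set.Ioc (0 : ℝ) ε, ‖f r‖ ^ 2 * r ^ l
      ≤ ∫ _ in Set.Ioc (0 : ℝ) ε, H :=
        setIntegral_mono_on hcont.integrableOn_Ioc continuous_const.integrableOn_Ioc
          measurableSet_Ioc fun r hr => norm_sq_mul_pow_le_integral_Ioi l hf hc hr.1
    _ = 1 * ε * H := by simp [hε.le]
end

section
/- Let E be a real inner product space and let d be a natural number with d ≥ 2. Then for every continuously differentiable function f : ℝ × ℝ → E whose support is a compact subset of the open quadrant (0,∞) × (0,∞), one has ∫_0^∞ ∫_0^∞ (rs)^{-2} ‖f(r,s)‖² r^{d+1} s^{d} ds dr ≤ (2/(d-1))² ∫_0^∞ ∫_0^∞ r^{-2} ‖∂_s f(r,s)‖² r^{d+1} s^{d} ds dr. -/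
open MeasureTheory Set

/-- Weighted Hardy inequality on the half-line for compactly supported `C¹` maps. -/
theorem hardy_integral_Ioi_pow {E : Type*} [NormedAddCommGroup E] [InnerProductSpace ℝ E]
    (k : ℕ) {g : ℝ → E} (hg : ContDiff ℝ 1 g) (hcpt : HasCompactSupport g) :
    ∫ s in Ioi (0 : ℝ), s ^ k * ‖g s‖ ^ 2 ≤
      (2 / ((k : ℝ) + 1)) ^ 2 * ∫ s in Ioi (0 : ℝ), s ^ (k + 2) * ‖deriv g s‖ ^ 2 := by
  have hg' : Continuous (deriv g) := hg.continuous_deriv le_rfl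
  have hgc : Continuous g := hg.continuous
  have hgd : Differentiable ℝ g := hg.differentiable one_ne_zero
  have hsq : HasCompactSupport fun s => ‖g s‖ ^ 2 :=
    hcpt.comp_left (g := fun x : E => ‖x‖ ^ 2) (by simp)
  have hdsq : HasCompactSupport fun s => ‖deriv g s‖ ^ 2 :=
    hcpt.deriv.comp_left (g := fun x : E => ‖x‖ ^ 2) (by simp)
  let h : ℝ → ℝ := fun s => s ^ (k + 1) * ‖g s‖ ^ 2
  have hh : ContDiff ℝ 1 h := (contDiff_id.pow (k + 1)).mul (hg.norm_sq ℝ)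
  have hhc : HasCompactSupport h := hsq.mul_left
  have hderiv (s : ℝ) : deriv h s =
      (k + 1) * s ^ k * ‖g s‖ ^ 2 + s ^ (k + 1) * (2 * inner ℝ (g s) (deriv g s)) := by
    have := (hasDerivAt_pow (k + 1) s).mul (hgd s).hasDerivAt.norm_sq
    simpa [h, Pi.mul_def] using this.deriv
  have hint : ∫ s in Ioi (0 : ℝ), deriv h s = 0 := by
    rw [hhc.integral_Ioi_deriv_eq hh 0]
    simp [h]
  have ih : Integrable (deriv h) (volume.restrict (Ioi 0)) :=
    ((hh.continuous_deriv le_rfl).integrable_of_hasCompactSupport hhc.deriv).restrict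
  have i₁ : Integrable (fun s => s ^ k * ‖g s‖ ^ 2) (volume.restrict (Ioi 0)) :=
    (Continuous.integrable_of_hasCompactSupport (by fun_prop) hsq.mul_left).restrict
  have i₂ : Integrable (fun s => s ^ (k + 2) * ‖deriv g s‖ ^ 2) (volume.restrict (Ioi 0)) :=
    (Continuous.integrable_of_hasCompactSupport (by fun_prop) hdsq.mul_left).restrict
  have key : ∫ s in Ioi (0 : ℝ), ((k : ℝ) + 1) ^ 2 * (s ^ k * ‖g s‖ ^ 2) ≤
      ∫ s in Ioi (0 : ℝ), (4 * (s ^ (k + 2) * ‖deriv g s‖ ^ 2) + 2 * ((k : ℝ) + 1) * deriv h s) := by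
    refine setIntegral_mono_on (i₁.const_mul _) ((i₂.const_mul _).add (ih.const_mul _))
      measurableSet_Ioi fun s hs => ?_
    have hexp := norm_add_sq_real (((k : ℝ) + 1) • g s) ((2 * s) • deriv g s)
    rw [norm_smul, norm_smul, mul_pow, mul_pow, Real.norm_eq_abs, Real.norm_eq_abs, sq_abs, sq_abs,
      real_inner_smul_left, real_inner_smul_right] at hexp
    have hnn := mul_nonneg (pow_nonneg (le_of_lt hs) k)
      (sq_nonneg ‖((k : ℝ) + 1) • g s + (2 * s) • deriv g s‖)
    rw [hexp] at hnn
    rw [hderiv, ← sub_nonneg]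
    convert hnn using 1
    ring
  rw [integral_const_mul, integral_add (i₂.const_mul _) (ih.const_mul _), integral_const_mul,
    integral_const_mul, hint, mul_zero, add_zero] at key
  rw [div_pow, div_mul_eq_mul_div, le_div_iff₀ (by positivity)]
  linarith

theorem mult_by_inv_dist_bounded_iterated_model
    {E : Type*} [NormedAddCommGroup E] [InnerProductSpace ℝ E]
    (d : ℕ) (hd : 2 ≤ d) (f : ℝ × ℝ → E) (hf : ContDiff ℝ 1 f)
    (hcpt : IsCompact (tsupport f))
    (hsupp : tsupport f ⊆ Set.Ioi (0 : ℝ) ×ˢ Set.Ioi (0 : ℝ)) :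
    ∫ r in Set.Ioi (0 : ℝ), ∫ s in Set.Ioi (0 : ℝ),
        ((r * s) ^ 2)⁻¹ * ‖f (r, s)‖ ^ 2 * r ^ (d + 1) * s ^ d ≤
      (2 / ((d : ℝ) - 1)) ^ 2 *
        ∫ r in Set.Ioi (0 : ℝ), ∫ s in Set.Ioi (0 : ℝ),
          (r ^ 2)⁻¹ * ‖deriv (fun t => f (r, t)) s‖ ^ 2 * r ^ (d + 1) * s ^ d := by
  obtain ⟨k, rfl⟩ := Nat.exists_eq_add_of_le' hd
  have hconst : ((k + 2 : ℕ) : ℝ) - 1 = k + 1 := by push_cast; ring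
  have hleft : ∀ r ∈ Ioi (0 : ℝ), ∫ s in Ioi (0 : ℝ),
      ((r * s) ^ 2)⁻¹ * ‖f (r, s)‖ ^ 2 * r ^ (k + 2 + 1) * s ^ (k + 2) =
      r ^ (k + 1) * ∫ s in Ioi (0 : ℝ), s ^ k * ‖f (r, s)‖ ^ 2 := by
    intro r hr
    rw [← integral_const_mul]
    refine setIntegral_congr_fun measurableSet_Ioi fun s hs => ?_
    have hr' : r ≠ 0 := ne_of_gt hr
    have hs' : s ≠ 0 := ne_of_gt hs
    field_simp
    ring
  have hright : ∀ r ∈ Ioi (0 : ℝ), ∫ s in Ioi (0 : ℝ),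
      (r ^ 2)⁻¹ * ‖deriv (fun t => f (r, t)) s‖ ^ 2 * r ^ (k + 2 + 1) * s ^ (k + 2) =
      r ^ (k + 1) * ∫ s in Ioi (0 : ℝ), s ^ (k + 2) * ‖deriv (fun t => f (r, t)) s‖ ^ 2 := by
    intro r hr
    rw [← integral_const_mul]
    refine setIntegral_congr_fun measurableSet_Ioi fun s _ => ?_
    have hr' : r ≠ 0 := ne_of_gt hr
    field_simp
    ring
  rw [setIntegral_congr_fun measurableSet_Ioi hleft, setIntegral_congr_fun measurableSet_Ioi hright,
    hconst, ← integral_const_mul]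
  have hpartial (r s : ℝ) : deriv (fun t => f (r, t)) s = fderiv ℝ f (r, s) (0, 1) :=
    ((hf.differentiable one_ne_zero (r, s)).hasFDerivAt.comp_hasDerivAt s
      ((hasDerivAt_const s r).prodMk (hasDerivAt_id s))).deriv
  have hslice (r : ℝ) : HasCompactSupport fun t => f (r, t) :=
    HasCompactSupport.comp_isClosedEmbedding hcpt 
      ⟨isEmbedding_prodMkRight r, by
        simpa [singleton_prod] using (isClosed_singleton (x := r)).prod (isClosed_univ (X := ℝ))⟩
  have hcont : Continuous fun p : ℝ × ℝ => fderiv ℝ f p (0, 1) :=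
    (hf.continuous_fderiv one_ne_zero).clm_apply continuous_const
  have hint : Integrable (fun p : ℝ × ℝ => p.1 ^ (k + 1) * p.2 ^ (k + 2) *
      ‖fderiv ℝ f p (0, 1)‖ ^ 2) := by
    refine Continuous.integrable_of_hasCompactSupport (by fun_prop) (HasCompactSupport.mul_left ?_)
    exact (HasCompactSupport.fderiv_apply (𝕜 := ℝ) hcpt (0, 1)).comp_left
      (g := fun x : E => ‖x‖ ^ 2) (by simp)
  have hint' : Integrable (fun r : ℝ => r ^ (k + 1) *
      ∫ s in Ioi (0 : ℝ), s ^ (k + 2) * ‖deriv (fun t => f (r, t)) s‖ ^ 2)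
      (volume.restrict (Ioi 0)) := by
    have h := hint.restrict (s := Ioi (0 : ℝ) ×ˢ Ioi (0 : ℝ))
    rw [Measure.volume_eq_prod, ← Measure.prod_restrict] at h
    simpa only [hpartial, ← integral_const_mul, mul_assoc] using h.integral_prod_left
  refine integral_mono_of_nonneg ?_ (hint'.const_mul _) ?_
  · filter_upwards [ae_restrict_mem measurableSet_Ioi] with r hr
    exact mul_nonneg (pow_nonneg (le_of_lt hr) _)
      (setIntegral_nonneg measurableSet_Ioi fun s hs =>
        mul_nonneg (pow_nonneg (le_of_lt hs) _) (sq_nonneg _))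
  · filter_upwards [ae_restrict_mem measurableSet_Ioi] with r hr
    have h := mul_le_mul_of_nonneg_left
      (hardy_integral_Ioi_pow k (hf.comp (contDiff_prodMk_right r)) (hslice r))
      (pow_nonneg (le_of_lt hr) (k + 1))
    exact h.trans_eq (mul_left_comm _ _ _)
end

section
/- Let l be a natural number with l ≥ 2, and let (f_k)_{k∈ℕ} be a sequence of continuously differentiable functions f_k : ℝ → ℝ, each vanishing on a neighborhood of the set (-∞, 0], and such that ∫_0^1 (f_k(r)² + f_k′(r)²) r^{l} dr ≤ 1 for all k. Then there is a subsequence (f_{k_i}) that is Cauchy in the weighted L²-norm on (0,1), i.e., ∫_0^1 (f_{k_i}(r) - f_{k_j}(r))² r^{l} dr → 0 as i, j → ∞. -/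
open MeasureTheory Set Filter

/-- If `F' ≤ a G + b` on `[x, y] ⊆ [0, 1]` with `G ≥ 0` of integral at most one on `(0, 1]`, then
`F y - F x ≤ a + b (y - x)`. -/
lemma sub_le_of_hasDerivAt_le_mul_add {F F' G : ℝ → ℝ} {a b x y : ℝ}
    (hF : ∀ r, HasDerivAt F (F' r) r) (hF' : Continuous F') (hG : Continuous G)
    (hG0 : ∀ r, 0 ≤ r → 0 ≤ G r) (hG1 : ∫ r in Ioc (0 : ℝ) 1, G r ≤ 1)
    (hx : 0 ≤ x) (hxy : x ≤ y) (hy : y ≤ 1) (ha : 0 ≤ a)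
    (hle : ∀ r, 0 ≤ r → r ≤ 1 → F' r ≤ a * G r + b) :
    F y - F x ≤ a + b * (y - x) := by
  have hGi : ∀ u v, IntervalIntegrable G volume u v := hG.intervalIntegrable
  have hGxy : ∫ r in x..y, G r ≤ 1 := by
    rw [intervalIntegral.integral_of_le hxy]
    refine (setIntegral_mono_set (hGi 0 1).1 ?_ ?_).trans hG1
    · filter_upwards [ae_restrict_mem measurableSet_Ioc] with r hr using hG0 r hr.1.le
    · exact (Ioc_subset_Ioc hx hy).eventuallyLE
  calc F y - F x = ∫ r in x..y, F' r :=
        (intervalIntegral.integral_eq_sub_of_hasDerivAt (fun r _ => hF r)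
          (hF'.intervalIntegrable _ _)).symm
    _ ≤ ∫ r in x..y, (a * G r + b) :=
        intervalIntegral.integral_mono_on hxy (hF'.intervalIntegrable _ _)
          ((by fun_prop : Continuous fun r => a * G r + b).intervalIntegrable _ _)
          fun r hr => hle r (hx.trans hr.1) (hr.2.trans hy)
    _ = a * (∫ r in x..y, G r) + b * (y - x) := by
        rw [intervalIntegral.integral_add ((hGi x y).const_mul a) (by simp),
          intervalIntegral.integral_const_mul, intervalIntegral.integral_const, smul_eq_mul,
          mul_comm b]
    _ ≤ a + b * (y - x) := by
        gcongr
        exact mul_le_of_le_one_right ha hGxy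

section WeightedSobolev

variable {m : ℕ} {f : ℝ → ℝ}

lemma continuous_weighted_energy (hf : ContDiff ℝ 1 f) (l : ℕ) :
    Continuous fun r => ((f r) ^ 2 + (deriv f r) ^ 2) * r ^ l := by
  have := hf.continuous
  have := hf.continuous_deriv le_rfl
  fun_prop

lemma sq_apply_one_le_of_weighted_energy_le (hf : ContDiff ℝ 1 f)
    (hb : ∫ r in Ioc (0 : ℝ) 1, ((f r) ^ 2 + (deriv f r) ^ 2) * r ^ (m + 2) ≤ 1) :
    f 1 ^ 2 ≤ m + 4 := by
  have hd : ∀ r, HasDerivAt f (deriv f r) r := fun r =>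
    (hf.differentiable one_ne_zero r).hasDerivAt
  have hc := hf.continuous
  have hc' := hf.continuous_deriv le_rfl
  have key := sub_le_of_hasDerivAt_le_mul_add (F := fun r => f r ^ 2 * r ^ (m + 3))
    (F' := fun r => 2 * f r * deriv f r * r ^ (m + 3) + f r ^ 2 * ((m + 3) * r ^ (m + 2)))
    (a := m + 4) (b := 0) (x := 0) (y := 1)
    (fun r => by
      refine HasDerivAt.congr_deriv (((hd r).pow 2).mul (hasDerivAt_pow (m + 3) r)) ?_
      push_cast
      simp)
    (by fun_prop) (continuous_weighted_energy hf (m + 2)) (fun r hr => by positivity) hb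
    le_rfl zero_le_one le_rfl (by positivity) ?_
  · simpa using key
  · intro r h0 h1
    have hp : 0 ≤ r ^ (m + 2) := by positivity
    have e : 2 * f r * deriv f r * r ≤ f r ^ 2 + deriv f r ^ 2 := by
      nlinarith [mul_nonneg h0 (sq_nonneg (f r - deriv f r)),
        mul_nonneg (sub_nonneg.2 h1) (add_nonneg (sq_nonneg (f r)) (sq_nonneg (deriv f r)))]
    have h3 : 0 ≤ ((m : ℝ) + 3) * deriv f r ^ 2 := by positivity
    calc _ = (2 * f r * deriv f r * r + (m + 3) * f r ^ 2) * r ^ (m + 2) := by ring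
      _ ≤ ((m + 4) * (f r ^ 2 + deriv f r ^ 2)) * r ^ (m + 2) := by
        gcongr
        linarith
      _ = _ := by ring

lemma sq_mul_pow_le_of_weighted_energy_le (hf : ContDiff ℝ 1 f)
    (hb : ∫ r in Ioc (0 : ℝ) 1, ((f r) ^ 2 + (deriv f r) ^ 2) * r ^ (m + 2) ≤ 1)
    {x : ℝ} (hx0 : 0 ≤ x) (hx1 : x ≤ 1) :
    f x ^ 2 * x ^ (m + 1) ≤ m + 5 := by
  have hd : ∀ r, HasDerivAt f (deriv f r) r := fun r =>
    (hf.differentiable one_ne_zero r).hasDerivAt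
  have hc := hf.continuous
  have hc' := hf.continuous_deriv le_rfl
  have key := sub_le_of_hasDerivAt_le_mul_add (F := fun r => -(f r ^ 2 * r ^ (m + 1)))
    (F' := fun r => -(2 * f r * deriv f r * r ^ (m + 1) + f r ^ 2 * ((m + 1) * r ^ m)))
    (a := 1) (b := 0) (x := x) (y := 1)
    (fun r => by
      refine HasDerivAt.congr_deriv ((((hd r).pow 2).mul (hasDerivAt_pow (m + 1) r)).neg) ?_
      push_cast
      simp)
    (by fun_prop) (continuous_weighted_energy hf (m + 2)) (fun r hr => by positivity) hb
    hx0 hx1 le_rfl zero_le_one ?_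
  · have := sq_apply_one_le_of_weighted_energy_le hf hb
    simp only [one_pow, mul_one, zero_mul, add_zero] at key
    linarith
  · intro r h0 h1
    have h : 0 ≤ ((deriv f r * r + f r) ^ 2 + m * f r ^ 2 + f r ^ 2 * r ^ 2) * r ^ m := by
      positivity
    rw [← sub_nonneg]
    convert h using 1
    ring

lemma abs_sub_le_of_weighted_energy_le (hf : ContDiff ℝ 1 f)
    (hb : ∫ r in Ioc (0 : ℝ) 1, ((f r) ^ 2 + (deriv f r) ^ 2) * r ^ (m + 2) ≤ 1)
    {x y : ℝ} (hx : 0 ≤ x) (hxy : x ≤ y) (hy : y ≤ 1) :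
    |f y * y ^ (m + 2) - f x * x ^ (m + 2)| ≤ (((m : ℝ) + 2) ^ 2 + 1) * √(y - x) := by
  rcases hxy.eq_or_lt with rfl | hlt
  · simp
  have hd : ∀ r, HasDerivAt f (deriv f r) r := fun r =>
    (hf.differentiable one_ne_zero r).hasDerivAt
  have hc := hf.continuous
  have hc' := hf.continuous_deriv le_rfl
  set t := √(y - x) with ht
  have ht0 : 0 < t := Real.sqrt_pos.2 (sub_pos.2 hlt)
  have htt : t ^ 2 = y - x := Real.sq_sqrt (sub_pos.2 hlt).le
  have hconst : t * ((m : ℝ) + 2) ^ 2 + t⁻¹ * (y - x) = (((m : ℝ) + 2) ^ 2 + 1) * t := by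
    rw [← htt]
    field_simp
  have hsgn : ∀ σ : ℝ, σ ^ 2 = 1 →
      σ * (f y * y ^ (m + 2) - f x * x ^ (m + 2)) ≤ (((m : ℝ) + 2) ^ 2 + 1) * t := by
    intro σ hσ
    have key := sub_le_of_hasDerivAt_le_mul_add (F := fun r => σ * (f r * r ^ (m + 2)))
      (F' := fun r => σ * (deriv f r * r ^ (m + 2) + f r * ((m + 2) * r ^ (m + 1))))
      (a := t * (m + 2) ^ 2) (b := t⁻¹) (x := x) (y := y)
      (fun r => by
        refine HasDerivAt.congr_deriv (((hd r).mul (hasDerivAt_pow (m + 2) r)).const_mul σ) ?_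
        push_cast
        simp)
      (by fun_prop) (continuous_weighted_energy hf (m + 2)) (fun r hr => by positivity) hb
      hx hxy hy (by positivity) ?_
    · rw [← hconst]
      linarith
    · intro r h0 h1
      set D := deriv f r * r ^ (m + 2) + f r * ((m + 2) * r ^ (m + 1)) with hD
      have hDsq : D ^ 2 ≤ 2 * ((m + 2) ^ 2 * ((f r ^ 2 + deriv f r ^ 2) * r ^ (m + 2))) := by
        have hr2 : r ^ 2 ≤ 1 := pow_le_one₀ h0 h1
        have hrm : r ^ m ≤ 1 := pow_le_one₀ h0 h1
        have hm : (1 : ℝ) ≤ (m + 2) ^ 2 := by nlinarith [(Nat.cast_nonneg m : (0 : ℝ) ≤ m)]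
        have h1' : (deriv f r * r + (m + 2) * f r) ^ 2
            ≤ 2 * ((m + 2) ^ 2 * (f r ^ 2 + deriv f r ^ 2)) := by
          nlinarith [sq_nonneg (deriv f r * r - (m + 2) * f r),
            mul_le_mul (hr2.trans hm) le_rfl (sq_nonneg (deriv f r)) (by positivity)]
        calc D ^ 2 = (deriv f r * r + (m + 2) * f r) ^ 2 * (r ^ (m + 2) * r ^ m) := by
              rw [hD]; ring
          _ ≤ 2 * ((m + 2) ^ 2 * (f r ^ 2 + deriv f r ^ 2)) * (r ^ (m + 2) * 1) := by gcongr
          _ = _ := by ring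
      have hamgm : σ * D ≤ t / 2 * D ^ 2 + t⁻¹ := by
        have h : 0 ≤ t⁻¹ / 2 * ((σ - t * D) ^ 2 + 1) := by positivity
        have e : t⁻¹ / 2 * ((σ - t * D) ^ 2 + 1) = t⁻¹ + t / 2 * D ^ 2 - σ * D := by
          rw [sub_sq, hσ]
          field_simp
          ring
        linarith
      calc σ * D ≤ t / 2 * D ^ 2 + t⁻¹ := hamgm
        _ ≤ t / 2 * (2 * ((m + 2) ^ 2 * ((f r ^ 2 + deriv f r ^ 2) * r ^ (m + 2)))) + t⁻¹ := by
          gcongr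
        _ = _ := by ring
  rw [abs_le]
  constructor
  · linarith [hsgn (-1) (by norm_num)]
  · linarith [hsgn 1 (by norm_num)]

end WeightedSobolev

/-- A sequence of functions on `[0, 1]`, vanishing at `0`, with a common `1/2`-Hölder bound has a
pointwise convergent subsequence. -/
lemma exists_subseq_tendsto_of_abs_sub_le_sqrt {w : ℕ → ℝ → ℝ} {C : ℝ} (hC : 0 ≤ C)
    (hw : ∀ k, Continuous (w k)) (hw0 : ∀ k, w k 0 = 0)
    (hH : ∀ k x y, 0 ≤ x → x ≤ y → y ≤ 1 → |w k y - w k x| ≤ C * √(y - x)) :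
    ∃ φ : ℕ → ℕ, StrictMono φ ∧ ∃ g : ℝ → ℝ, ∀ x ∈ Icc (0 : ℝ) 1,
      Tendsto (fun i => w (φ i) x) atTop (nhds (g x)) := by
  let W : ℕ → BoundedContinuousFunction (Icc (0 : ℝ) 1) ℝ := fun k =>
    BoundedContinuousFunction.mkOfCompact
      ⟨fun x => w k x, (hw k).comp continuous_subtype_val⟩
  have hcomp : IsCompact (closure (range W)) := by
    refine BoundedContinuousFunction.arzela_ascoli (Metric.closedBall 0 C)
      (isCompact_closedBall 0 C) (range W) ?_ ?_
    · rintro _ ⟨x, hx0, hx1⟩ ⟨k, rfl⟩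
      have h := hH k 0 x le_rfl hx0 hx1
      rw [hw0, sub_zero, sub_zero] at h
      rw [mem_closedBall_zero_iff, Real.norm_eq_abs]
      exact h.trans (mul_le_of_le_one_right hC (Real.sqrt_le_one.2 hx1))
    · refine Metric.equicontinuous_of_continuity_modulus (fun d => C * √d) ?_ _ ?_
      · have : Continuous fun d : ℝ => C * √d := by fun_prop
        simpa using this.tendsto 0
      · rintro x y ⟨_, k, rfl⟩
        change |w k x - w k y| ≤ C * √|(x : ℝ) - y|
        rcases le_total (x : ℝ) y with h | h
        · rw [abs_sub_comm, abs_sub_comm (x : ℝ), abs_of_nonneg (sub_nonneg.2 h)]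
          exact hH k x y x.2.1 h y.2.2
        · rw [abs_of_nonneg (sub_nonneg.2 h)]
          exact hH k y x y.2.1 h x.2.2
  obtain ⟨g, -, φ, hφ, hg⟩ :=
    hcomp.tendsto_subseq (x := W) fun k => subset_closure (mem_range_self k)
  refine ⟨φ, hφ, fun x => if hx : x ∈ Icc (0 : ℝ) 1 then g ⟨x, hx⟩ else 0, fun x hx => ?_⟩
  simp only [dif_pos hx]
  exact ((BoundedContinuousFunction.lipschitz_eval_const
    (⟨x, hx⟩ : Icc (0 : ℝ) 1)).continuous.tendsto g).comp hg

/-- One-dimensional model case of the Rellich–Kondrachov compactness theorem for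
manifolds with fiberwise asymptotically conical singularities whose links have
dimension `l ≥ 2`: a sequence bounded in the weighted `H¹`-norm on the truncated
cone has a subsequence that is Cauchy in the weighted `L²`-norm. -/
theorem rellich_kondrachov_model
    (l : ℕ) (hl : 2 ≤ l) (f : ℕ → ℝ → ℝ)
    (hf : ∀ k, ContDiff ℝ 1 (f k))
    (hvan : ∀ k, ∃ ε > (0 : ℝ), ∀ x : ℝ, x < ε → f k x = 0)
    (hbdd : ∀ k, ∫ r in Set.Ioc (0 : ℝ) 1,
      ((f k r) ^ 2 + (deriv (f k) r) ^ 2) * r ^ l ≤ 1) :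
    ∃ φ : ℕ → ℕ, StrictMono φ ∧
      Tendsto (fun p : ℕ × ℕ =>
          ∫ r in Set.Ioc (0 : ℝ) 1, (f (φ p.1) r - f (φ p.2) r) ^ 2 * r ^ l)
        atTop (nhds 0) := by
  obtain ⟨m, rfl⟩ := Nat.exists_eq_add_of_le' hl
  have hc : ∀ k, Continuous (f k) := fun k => (hf k).continuous
  obtain ⟨φ, hφ, g, hg⟩ := exists_subseq_tendsto_of_abs_sub_le_sqrt
    (w := fun k r => f k r * r ^ (m + 2)) (C := ((m : ℝ) + 2) ^ 2 + 1) (by positivity)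
    (fun k => (hc k).mul (continuous_pow _)) (by simp)
    (fun k x y hx hxy hy => abs_sub_le_of_weighted_energy_le (hf k) (hbdd k) hx hxy hy)
  refine ⟨φ, hφ, ?_⟩
  rw [show nhds (0 : ℝ) = nhds (∫ _ in Ioc (0 : ℝ) 1, (0 : ℝ)) by simp]
  refine tendsto_integral_filter_of_dominated_convergence (fun _ => 4 * ((m : ℝ) + 5)) ?_ ?_
    (integrable_const _) ?_
  · refine Eventually.of_forall fun p => Continuous.aestronglyMeasurable ?_
    exact (((hc _).sub (hc _)).pow 2).mul (continuous_pow _)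
  · refine Eventually.of_forall fun p => ?_
    filter_upwards [ae_restrict_mem measurableSet_Ioc] with r hr
    have hr0 := hr.1.le
    have hb : ∀ k, f k r ^ 2 * r ^ (m + 2) ≤ m + 5 := fun k =>
      (mul_le_mul_of_nonneg_left (pow_le_pow_of_le_one hr0 hr.2 (Nat.le_succ _))
        (sq_nonneg _)).trans (sq_mul_pow_le_of_weighted_energy_le (hf k) (hbdd k) hr0 hr.2)
    rw [Real.norm_of_nonneg (by positivity)]
    have h : 0 ≤ (f (φ p.1) r + f (φ p.2) r) ^ 2 * r ^ (m + 2) := by positivity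
    linarith [hb (φ p.1), hb (φ p.2)]
  · filter_upwards [ae_restrict_mem measurableSet_Ioc] with r hr
    have hpow : r ^ (m + 2) ≠ 0 := (pow_pos hr.1 _).ne'
    have hlim : Tendsto (fun i => f (φ i) r) atTop (nhds (g r / r ^ (m + 2))) := by
      refine ((hg r ⟨hr.1.le, hr.2⟩).div_const (r ^ (m + 2))).congr fun i => ?_
      exact mul_div_cancel_right₀ _ hpow
    rw [← prod_atTop_atTop_eq]
    simpa using (((hlim.comp tendsto_fst).sub (hlim.comp tendsto_snd)).pow 2).mul_const
      (r ^ (m + 2))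
end
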